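/- Let I ⊆ [n]. Then there exists a lacunar subset J of [n−1] such that sum J ≤ sum I and J' ⊆ I'. -/

import Mathlib

noncomputable section

namespace OneSidedCycleShuffles

/-- `sw n i` is the simple transposition `s_i ∈ S_n` (1-indexed: it swaps the values `i` and
`i+1` of `[n] = {1,…,n}`, realized on the carrier `Fin n` via the identification
`x ∈ [n] ↔ ⟨x-1⟩ : Fin n`); it is the junk value `1` unless `i ∈ [n-1]`. -/
def sw (n i : ℕ) : Equiv.Perm (Fin n) :=
  if h : 1 ≤ i ∧ i < n then Equiv.swap ⟨i - 1, by omega⟩ ⟨i, h.2⟩ else 1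

/-- `cyc n l j` is the cycle `cyc_{l,l+1,…,j} ∈ S_n` (sending `l,…,j-1,j` to `l+1,…,j,l`),
written as the product `s_l s_{l+1} ⋯ s_{j-1}` of simple transpositions. -/
def cyc (n l j : ℕ) : Equiv.Perm (Fin n) :=
  ((List.range' l (j - l)).map (sw n)).prod

/-- The somewhere-to-below shuffle `t_ℓ = cyc_ℓ + cyc_{ℓ,ℓ+1} + ⋯ + cyc_{ℓ,ℓ+1,…,n} ∈ k[S_n]`. -/
def t (n : ℕ) (k : Type*) [CommRing k] (l : ℕ) : MonoidAlgebra k (Equiv.Perm (Fin n)) :=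
  ∑ j ∈ Finset.Icc l n, MonoidAlgebra.of k (Equiv.Perm (Fin n)) (cyc n l j)

/-- `m_{I,ℓ}` : (the smallest element of the enclosure `{0} ∪ I ∪ {n+1}` that is `≥ ℓ`) `- ℓ`. -/
def mIdx (n : ℕ) (I : Finset ℕ) (l : ℕ) : ℕ :=
  sInf {x : ℕ | (x = 0 ∨ x ∈ I ∨ x = n + 1) ∧ l ≤ x} - l

/-- The non-shadow `I' = [n-1] \ (I ∪ (I-1))`. -/
def nonShadow (n : ℕ) (I : Finset ℕ) : Finset ℕ :=
  Finset.Icc 1 (n - 1) \ (I ∪ I.image (fun i => i - 1))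

/-- A set of integers is lacunar if it contains no two consecutive integers. -/
def Lacunar (I : Finset ℕ) : Prop := ∀ i ∈ I, i + 1 ∉ I

instance : DecidablePred Lacunar := fun I =>
  decidable_of_iff (∀ i ∈ I, i + 1 ∉ I) Iff.rfl

/-- The invariant space `F(I) = {q ∈ k[S_n] : q s_i = q for all i ∈ I'}`. -/
def F (n : ℕ) (k : Type*) [CommRing k] (I : Finset ℕ) :
    Submodule k (MonoidAlgebra k (Equiv.Perm (Fin n))) where
  carrier := {q | ∀ i ∈ nonShadow n I, q * MonoidAlgebra.of k (Equiv.Perm (Fin n)) (sw n i) = q}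
  add_mem' := by
    intro a b ha hb i hi
    rw [add_mul, ha i hi, hb i hi]
  zero_mem' := by
    intro i hi
    rw [zero_mul]
  smul_mem' := by
    intro c a ha i hi
    rw [smul_mul_assoc, ha i hi]

/-- `F(<c) = ∑_{J ⊆ [n], sum J < c} F(J)`. -/
def Flt (n : ℕ) (k : Type*) [CommRing k] (c : ℕ) :
    Submodule k (MonoidAlgebra k (Equiv.Perm (Fin n))) :=
  ∑ J ∈ (Finset.Icc 1 n).powerset.filter (fun J => J.sum id < c), F n k J

/-- `F_i = F(Q_1) + ⋯ + F(Q_i)` for an enumeration `Q` of the lacunar subsets of `[n-1]`. -/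
def Fi (n : ℕ) (k : Type*) [CommRing k] (Q : ℕ → Finset ℕ) (i : ℕ) :
    Submodule k (MonoidAlgebra k (Equiv.Perm (Fin n))) :=
  ∑ j ∈ Finset.Icc 1 i, F n k (Q j)

/-- The (1-indexed) value `w(i) ∈ [n]` of a permutation `w ∈ S_n` at `i ∈ [n]`
(junk value `0` if out of range). -/
def pval (n : ℕ) (w : Equiv.Perm (Fin n)) (i : ℕ) : ℕ :=
  if h : i - 1 < n then (w ⟨i - 1, h⟩).val + 1 else 0

/-- The descent set `Des w = {i ∈ [n-1] : w(i) > w(i+1)}`. -/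
def Des (n : ℕ) (w : Equiv.Perm (Fin n)) : Finset ℕ :=
  (Finset.Icc 1 (n - 1)).filter fun i => pval n w (i + 1) < pval n w i

/-- `G(T)` : the subgroup of `S_n` generated by the simple transpositions `s_i`, `i ∈ T`. -/
def G (n : ℕ) (T : Finset ℕ) : Subgroup (Equiv.Perm (Fin n)) :=
  Subgroup.closure ((T.image (sw n) : Finset (Equiv.Perm (Fin n))) : Set (Equiv.Perm (Fin n)))

open scoped Classical in
/-- `a_w = ∑_{σ ∈ G(Des w)} wσ ∈ k[S_n]`. -/
def aw (n : ℕ) (k : Type*) [CommRing k] (w : Equiv.Perm (Fin n)) :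
    MonoidAlgebra k (Equiv.Perm (Fin n)) :=
  ∑ σ ∈ Finset.univ.filter (fun σ => σ ∈ G n (Des n w)),
    MonoidAlgebra.of k (Equiv.Perm (Fin n)) (w * σ)

/-- The Q-index of `w` : the smallest `i ∈ [f_{n+1}]` with `Q_i' ⊆ Des w`. -/
def Qind (n : ℕ) (Q : ℕ → Finset ℕ) (w : Equiv.Perm (Fin n)) : ℕ :=
  sInf {i : ℕ | 1 ≤ i ∧ i ≤ Nat.fib (n + 1) ∧ nonShadow n (Q i) ⊆ Des n w}

/-- The set of inversions of `u ∈ S_n` : pairs `(i,j) ∈ [n] × [n]` with `i < j`, `u(i) > u(j)`. -/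
def InvSet (n : ℕ) (u : Equiv.Perm (Fin n)) : Finset (ℕ × ℕ) :=
  (Finset.Icc 1 n ×ˢ Finset.Icc 1 n).filter fun p => p.1 < p.2 ∧ pval n u p.2 < pval n u p.1

/-- The lexicographic order on `S_n` : `u < v` iff at the smallest `i ∈ [n]` where they
differ, `u(i) < v(i)`. -/
def lexLT (n : ℕ) (u v : Equiv.Perm (Fin n)) : Prop :=
  ∃ i ∈ Finset.Icc 1 n, pval n u i < pval n v i ∧
    ∀ j ∈ Finset.Icc 1 n, j < i → pval n u j = pval n v j

/-- `Z(I) = {q ∈ k[S_n] : q s_i = q for all i ∈ I}`. -/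
def Z (n : ℕ) (k : Type*) [CommRing k] (I : Finset ℕ) :
    Submodule k (MonoidAlgebra k (Equiv.Perm (Fin n))) where
  carrier := {q | ∀ i ∈ I, q * MonoidAlgebra.of k (Equiv.Perm (Fin n)) (sw n i) = q}
  add_mem' := by
    intro a b ha hb i hi
    rw [add_mul, ha i hi, hb i hi]
  zero_mem' := by
    intro i hi
    rw [zero_mul]
  smul_mem' := by
    intro c a ha i hi
    rw [smul_mul_assoc, ha i hi]

/-- `R(x)` : right multiplication by `x`, as a `k`-module endomorphism of `k[S_n]`. -/
def Rmul (n : ℕ) (k : Type*) [CommRing k] (x : MonoidAlgebra k (Equiv.Perm (Fin n))) :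
    Module.End k (MonoidAlgebra k (Equiv.Perm (Fin n))) :=
  LinearMap.mulRight k x


/-- Lowering an element `i` of `I` by one (and discarding the result if it is `0`). -/
def lower (I : Finset ℕ) (i : ℕ) : Finset ℕ :=
  (insert (i - 1) (I.erase i)).erase 0

theorem mem_lower {I : Finset ℕ} {i x : ℕ} :
    x ∈ lower I i ↔ x ≠ 0 ∧ (x = i - 1 ∨ x ≠ i ∧ x ∈ I) := by
  simp [lower]

theorem mem_nonShadow {n x : ℕ} {I : Finset ℕ} (hI : I ⊆ Finset.Icc 1 n) :
    x ∈ nonShadow n I ↔ (1 ≤ x ∧ x ≤ n - 1) ∧ x ∉ I ∧ x + 1 ∉ I := by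
  have key : (∃ a ∈ I, a - 1 = x) ↔ x + 1 ∈ I := by
    constructor
    · rintro ⟨a, ha, rfl⟩
      have := Finset.mem_Icc.1 (hI ha)
      rwa [Nat.sub_add_cancel this.1]
    · exact fun h => ⟨x + 1, h, rfl⟩
  simp only [nonShadow, Finset.mem_sdiff, Finset.mem_Icc, Finset.mem_union, Finset.mem_image,
    key, not_or]

theorem lower_subset {n i : ℕ} {I : Finset ℕ} (hI : I ⊆ Finset.Icc 1 n) (hi : i ∈ I) :
    lower I i ⊆ Finset.Icc 1 n := by
  intro x hx
  have hin := Finset.mem_Icc.1 (hI hi)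
  obtain ⟨h0, rfl | ⟨-, hxI⟩⟩ := mem_lower.1 hx
  · rw [Finset.mem_Icc]
    omega
  · exact hI hxI

theorem sum_lower_lt {i : ℕ} {I : Finset ℕ} (h1 : 1 ≤ i) (hi : i ∈ I) :
    (lower I i).sum id < I.sum id := by
  have hI : (I.erase i).sum id + i = I.sum id := Finset.sum_erase_add I id hi
  have hle : (lower I i).sum id ≤ (insert (i - 1) (I.erase i)).sum id :=
    Finset.sum_le_sum_of_subset (Finset.erase_subset _ _)
  have hins : (insert (i - 1) (I.erase i)).sum id ≤ (i - 1) + (I.erase i).sum id := by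
    by_cases h : i - 1 ∈ I.erase i
    · rw [Finset.insert_eq_of_mem h]
      exact Nat.le_add_left _ _
    · rw [Finset.sum_insert h, id]
  omega

/-- Lowering `i` preserves the shadow in `[n-1]` when `i` itself stays covered by `i + 1`, or
lies outside `[n-1]`. -/
theorem nonShadow_lower_subset {n i : ℕ} {I : Finset ℕ} (hI : I ⊆ Finset.Icc 1 n)
    (hi : i ∈ I) (h : i = n ∨ i + 1 ∈ I) : nonShadow n (lower I i) ⊆ nonShadow n I := by
  intro x
  rw [mem_nonShadow (lower_subset hI hi), mem_nonShadow hI, mem_lower, mem_lower]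
  rintro ⟨hx, h1, h2⟩
  refine ⟨hx, fun hxI => ?_, fun hxI => ?_⟩
  · by_cases hxi : x = i
    · subst hxi
      rcases h with h | h
      · omega
      · exact h2 ⟨by omega, Or.inr ⟨by omega, h⟩⟩
    · exact h1 ⟨by omega, Or.inr ⟨hxi, hxI⟩⟩
  · by_cases hxi : x + 1 = i
    · exact h1 ⟨by omega, Or.inl (by omega)⟩
    · exact h2 ⟨by omega, Or.inr ⟨hxi, hxI⟩⟩

/-- Corollary `cor.FI-lac-2`. For every `I ⊆ [n]` there is a lacunar subset
`J` of `[n-1]` with `sum J ≤ sum I` and `J' ⊆ I'`. -/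
theorem exists_lacunar_le_sum (n : ℕ) (I : Finset ℕ) (hI : I ⊆ Finset.Icc 1 n) :
    ∃ J : Finset ℕ, J ⊆ Finset.Icc 1 (n - 1) ∧ Lacunar J ∧
      J.sum id ≤ I.sum id ∧ nonShadow n J ⊆ nonShadow n I := by
  induction hs : I.sum id using Nat.strong_induction_on generalizing I with
  | _ s ih =>
    subst hs
    by_cases h : ∃ i ∈ I, i = n ∨ i + 1 ∈ I
    · obtain ⟨i, hi, h⟩ := h
      have hlt := sum_lower_lt (Finset.mem_Icc.1 (hI hi)).1 hi
      obtain ⟨J, hJ, hlac, hsum, hsub⟩ := ih _ hlt _ (lower_subset hI hi) rfl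
      exact ⟨J, hJ, hlac, hsum.trans hlt.le, hsub.trans (nonShadow_lower_subset hI hi h)⟩
    · push Not at h
      refine ⟨I, fun x hx => ?_, fun i hi => (h i hi).2, le_rfl, subset_rfl⟩
      have hxn := Finset.mem_Icc.1 (hI hx)
      have := (h x hx).1
      rw [Finset.mem_Icc]
      omega

end OneSidedCycleShuffles
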